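/- arXiv:1105.2807 — 2 statements merged into one kernel-verified Lean document; each statement's English description precedes it below -/
import Mathlib

section
/- Let P ⊂ ℝ⁶ be the convex polytope of all tuples (t_{j,k})_{j≠k}, indexed by ordered pairs (j,k) with j ≠ k ∈ {1,2,3}, satisfying t_{j,k} ≥ 0 for all j ≠ k and t_{j,k} + t_{j,l} + 2t_{k,j} + 2t_{l,j} ≤ 1 for all (j,k,l) ∈ {(1,2,3),(2,3,1),(3,1,2)}. Then the six-dimensional Lebesgue volume of P equals 1/(4·6!) = 1/2880. -/
open MeasureTheory

/-- The six ordered pairs `(j,k)` with `j ≠ k ∈ {1,2,3}`, indexing the coordinates of `ℝ⁶`. -/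
abbrev Pair : Type := {p : Fin 3 × Fin 3 // p.1 ≠ p.2}

/-- The polytope in the nonnegative orthant cut out by the inequalities `∑ p, a p * t p ≤ 1`
for the coefficient vectors `a` in `L`. -/
def rowPolytope {ι : Type*} [Fintype ι] (L : List (ι → ℕ)) : Set (ι → ℝ) :=
  {t | (∀ p, 0 ≤ t p) ∧ ∀ a ∈ L, ∑ p, (a p : ℝ) * t p ≤ 1}

/-- The row `a` with its `j`-th entry replaced by `l * a i + m * a j`. -/
def mixEntry {ι : Type*} [DecidableEq ι] (i j : ι) (l m : ℕ) (a : ι → ℕ) : ι → ℕ :=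
  Function.update a j (l * a i + m * a j)

/-- The volume of `rowPolytope L`, relative to the standard simplex, computed by dropping
dominated rows and splitting the orthant along hyperplanes `l * t j = m * t i`
until a single row is left. The list `e` holds the coordinates tested for a splitting. -/
def relVolume {ι : Type*} [Fintype ι] [DecidableEq ι] (e : List ι) :
    ℕ → List (ι → ℕ) → Option ℚ
  | 0, _ => none
  | _ + 1, [] => none
  | _ + 1, [a] => if ∀ p, 0 < a p then some (∏ p, (a p : ℚ))⁻¹ else none
  | n + 1, a :: b :: L =>
    if ∀ p, a p ≤ b p then relVolume e n (b :: L)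
    else if ∀ p, b p ≤ a p then relVolume e n (a :: L)
    else
      match e.find? (fun p => a p < b p), e.find? (fun p => b p < a p) with
      | some i, some j =>
        match relVolume e n ((a :: b :: L).map (mixEntry i j (a j - b j) (b i - a i))),
          relVolume e n ((a :: b :: L).map (mixEntry j i (b i - a i) (a j - b j))) with
        | some x, some y => some ((b i - a i : ℕ) * x + (a j - b j : ℕ) * y)
        | _, _ => none
      | _, _ => none

/-- The three rows of the polytope in `stmt7` have relative volume `1 / 4`. -/
theorem relVolume_eval : relVolume (ι := Pair)
    [⟨(0, 1), by decide⟩, ⟨(0, 2), by decide⟩, ⟨(1, 0), by decide⟩, ⟨(1, 2), by decide⟩,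
      ⟨(2, 0), by decide⟩, ⟨(2, 1), by decide⟩] 12
    ([0, 1, 2].map fun j p => if p.1.1 = j then 1 else if p.1.2 = j then 2 else 0) =
    some (1 / 4) := by
  decide +kernel

theorem measurableSet_rowPolytope {ι : Type*} [Fintype ι] (L : List (ι → ℕ)) :
    MeasurableSet (rowPolytope L) := by
  apply IsClosed.measurableSet
  have : rowPolytope L = (⋂ p, {t | 0 ≤ t p}) ∩
      ⋂ a ∈ L, {t : ι → ℝ | ∑ p, (a p : ℝ) * t p ≤ 1} := by
    ext t; simp [rowPolytope]
  rw [this]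
  refine (isClosed_iInter fun p => isClosed_le (by fun_prop) (by fun_prop)).inter
    (isClosed_biInter fun a _ => isClosed_le (by fun_prop) (by fun_prop))

/-- Dropping a dominated row does not change the polytope. -/
theorem rowPolytope_cons_of_le {ι : Type*} [Fintype ι] {a b : ι → ℕ} {L : List (ι → ℕ)}
    (hb : b ∈ L) (hab : ∀ p, a p ≤ b p) : rowPolytope (a :: L) = rowPolytope L := by
  ext t
  simp only [rowPolytope, List.mem_cons, forall_eq_or_imp, Set.mem_ofPred_eq]
  refine ⟨fun ⟨h0, _, h⟩ => ⟨h0, h⟩, fun ⟨h0, h⟩ => ⟨h0, ?_, h⟩⟩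
  refine le_trans (Finset.sum_le_sum fun p _ => ?_) (h b hb)
  exact mul_le_mul_of_nonneg_right (by exact_mod_cast hab p) (h0 p)

theorem rowPolytope_swap {ι : Type*} [Fintype ι] (a b : ι → ℕ) (L : List (ι → ℕ)) :
    rowPolytope (a :: b :: L) = rowPolytope (b :: a :: L) := by
  ext t
  simp only [rowPolytope, List.mem_cons, forall_eq_or_imp, Set.mem_ofPred_eq]
  tauto

/-- The part of the polytope where `l * t j ≤ m * t i` is the linear image of the polytope with
mixed rows. -/
theorem volume_rowPolytope_map_mixEntry {ι : Type*} [Fintype ι] [DecidableEq ι] {i j : ι}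
    (hij : i ≠ j) {l m : ℕ} (hl : 0 < l) (hm : 0 < m) (L : List (ι → ℕ)) :
    volume (rowPolytope L ∩ {t | (l : ℝ) * t j ≤ m * t i}) =
      ENNReal.ofReal m * volume (rowPolytope (L.map (mixEntry i j l m))) := by
  set v : ι → ℝ := (l : ℝ) • Pi.single i 1 + (m : ℝ) • Pi.single j 1 with hv
  set M : Matrix ι ι ℝ := (1 : Matrix ι ι ℝ).updateCol j v with hM
  have hm' : (0 : ℝ) < m := by exact_mod_cast hm
  have hl' : (0 : ℝ) < l := by exact_mod_cast hl
  have hdet : LinearMap.det (Matrix.toLin' M) = m := by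
    rw [LinearMap.det_toLin', hM, ← Matrix.cramer_apply, Matrix.cramer_one]
    simp [hv, hij]
  have hMi (t : ι → ℝ) (k : ι) :
      (M.mulVec t) k = if k = i then t i + l * t j else if k = j then m * t j else t k := by
    have hM' : M.mulVec t = Function.update t j 0 + t j • v := by
      ext k
      have h (p : ι) : M k p * t p =
          (if p = k then Function.update t j 0 k else 0) + if p = j then t j * v k else 0 := by
        rw [hM, Matrix.updateCol_apply, Matrix.one_apply]
        rcases eq_or_ne p j with rfl | hp
        · rcases eq_or_ne p k with rfl | hk <;> simp [*, mul_comm]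
        · rcases eq_or_ne p k with rfl | hk <;> simp [*, Ne.symm]
      simp [Matrix.mulVec, dotProduct, h, Finset.sum_add_distrib]
    rw [hM', hv]
    rcases eq_or_ne k i with rfl | hki
    · simp [hij, mul_comm]
    · rcases eq_or_ne k j with rfl | hkj <;> simp [*, mul_comm]
  have hsum (a : ι → ℕ) (t : ι → ℝ) :
      ∑ p, (a p : ℝ) * (M.mulVec t) p = ∑ p, (mixEntry i j l m a p : ℝ) * t p := by
    have h (p : ι) : (a p : ℝ) * (M.mulVec t) p - (mixEntry i j l m a p : ℝ) * t p =
        (if p = i then (a i : ℝ) * (l * t j) else 0) -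
          if p = j then (a i : ℝ) * (l * t j) else 0 := by
      rw [hMi, mixEntry]
      rcases eq_or_ne p i with rfl | hpi
      · simp [hij]; ring
      · rcases eq_or_ne p j with rfl | hpj
        · simp [hpi]; ring
        · simp [hpi, hpj]
    rw [← sub_eq_zero, ← Finset.sum_sub_distrib]
    simp [h]
  have hpre : Matrix.toLin' M ⁻¹' (rowPolytope L ∩ {t | (l : ℝ) * t j ≤ m * t i}) =
      rowPolytope (L.map (mixEntry i j l m)) := by
    ext t
    simp only [rowPolytope, Set.mem_preimage, Set.mem_inter_iff, Set.mem_ofPred_eq,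
      Matrix.toLin'_apply, hsum, List.mem_map, forall_exists_index, and_imp,
      forall_apply_eq_imp_iff₂]
    have hi := hMi t i
    have hj := hMi t j
    simp only [if_true, hij.symm, if_false] at hi hj
    constructor
    · rintro ⟨⟨h0, h⟩, h1⟩
      refine ⟨fun k => ?_, h⟩
      rw [hi, hj] at h1
      have hk := h0 k
      rw [hMi] at hk
      split_ifs at hk with h2 h3
      · subst h2; nlinarith
      · subst h3; exact nonneg_of_mul_nonneg_right hk hm'
      · exact hk
    · rintro ⟨h0, h⟩
      refine ⟨⟨fun k => ?_, h⟩, ?_⟩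
      · rw [hMi]
        have := h0 i
        have := h0 j
        have := h0 k
        split_ifs <;> positivity
      · rw [hi, hj]
        nlinarith [mul_nonneg hm'.le (h0 i)]
  rw [← hpre, Measure.addHaar_preimage_linearMap _ (by rw [hdet]; exact hm'.ne'), hdet,
    ← mul_assoc, ← ENNReal.ofReal_mul hm'.le, abs_of_pos (inv_pos.2 hm'),
    mul_inv_cancel₀ hm'.ne', ENNReal.ofReal_one, one_mul]

theorem volume_setOf_mul_eq_mul {ι : Type*} [Fintype ι] [DecidableEq ι] {i j : ι} (hij : i ≠ j)
    {l : ℝ} (hl : l ≠ 0) (m : ℝ) : volume {t : ι → ℝ | l * t j = m * t i} = 0 := by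
  set f : (ι → ℝ) →ₗ[ℝ] ℝ := l • LinearMap.proj j - m • LinearMap.proj i with hf
  have : {t : ι → ℝ | l * t j = m * t i} = (LinearMap.ker f : Set (ι → ℝ)) := by
    ext t; simp [hf, sub_eq_zero]
  rw [this]
  apply Measure.addHaar_submodule
  intro h
  have : Pi.single j 1 ∈ LinearMap.ker f := h ▸ Submodule.mem_top
  simp [hf, hij, hl] at this

/-- Splitting the polytope along the hyperplane `l * t j = m * t i`. -/
theorem volume_rowPolytope_eq_add {ι : Type*} [Fintype ι] [DecidableEq ι] {i j : ι}
    (hij : i ≠ j) {l m : ℕ} (hl : 0 < l) (hm : 0 < m) (L : List (ι → ℕ)) :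
    volume (rowPolytope L) =
      ENNReal.ofReal m * volume (rowPolytope (L.map (mixEntry i j l m))) +
      ENNReal.ofReal l * volume (rowPolytope (L.map (mixEntry j i m l))) := by
  rw [← volume_rowPolytope_map_mixEntry hij hl hm,
    ← volume_rowPolytope_map_mixEntry hij.symm hm hl, ← measure_union₀]
  · congr 1
    ext t
    simp [← Set.inter_union_distrib_left, le_total]
  · refine ((measurableSet_rowPolytope L).inter ?_).nullMeasurableSet
    exact measurableSet_le (by fun_prop) (by fun_prop)
  · refine measure_mono_null ?_
      (volume_setOf_mul_eq_mul hij (l := (l : ℝ)) (by exact_mod_cast hl.ne') (m : ℝ))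
    rintro t ⟨⟨_, h1⟩, ⟨_, h2⟩⟩
    exact le_antisymm h1 h2

/-- A polytope with a single positive row is a rescaled standard simplex. -/
theorem volume_rowPolytope_singleton {ι : Type*} [Fintype ι] [DecidableEq ι] {a : ι → ℕ}
    (ha : ∀ p, 0 < a p) :
    volume (rowPolytope [a]) =
      ENNReal.ofReal (∏ p, (a p : ℝ))⁻¹ * volume (rowPolytope [(1 : ι → ℕ)]) := by
  have ha' (p : ι) : (0 : ℝ) < a p := by exact_mod_cast ha p
  have hpos : 0 < ∏ p, (a p : ℝ) := Finset.prod_pos fun p _ => ha' p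
  have hdet : LinearMap.det (Matrix.toLin' (Matrix.diagonal fun p => (a p : ℝ))) =
      ∏ p, (a p : ℝ) := by
    rw [LinearMap.det_toLin', Matrix.det_diagonal]
  have hpre : Matrix.toLin' (Matrix.diagonal fun p => (a p : ℝ)) ⁻¹'
      rowPolytope [(1 : ι → ℕ)] = rowPolytope [a] := by
    ext t
    simp [rowPolytope, Matrix.mulVec_diagonal, mul_nonneg_iff_of_pos_left, ha]
  rw [← hpre, Measure.addHaar_preimage_linearMap _ (by rw [hdet]; exact hpos.ne'), hdet,
    abs_of_pos (inv_pos.2 hpos)]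

/-- Correctness of `relVolume`. -/
theorem volume_rowPolytope_of_relVolume {ι : Type*} [Fintype ι] [DecidableEq ι] (e : List ι)
    (n : ℕ) (L : List (ι → ℕ)) (q : ℚ) (h : relVolume e n L = some q) :
    0 ≤ q ∧ volume (rowPolytope L) =
      ENNReal.ofReal q * volume (rowPolytope [(1 : ι → ℕ)]) := by
  induction n generalizing L q with
  | zero => simp [relVolume] at h
  | succ n ih =>
    match L with
    | [] => simp [relVolume] at h
    | [a] =>
      simp only [relVolume, Option.ite_none_right_eq_some, Option.some.injEq] at h
      obtain ⟨ha, rfl⟩ := h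
      refine ⟨by positivity, ?_⟩
      rw [volume_rowPolytope_singleton ha]
      push_cast
      rfl
    | a :: b :: L =>
      rw [relVolume] at h
      split_ifs at h with hab hba
      · rw [rowPolytope_cons_of_le (List.mem_cons_self ..) hab]
        exact ih _ _ h
      · rw [rowPolytope_swap, rowPolytope_cons_of_le (List.mem_cons_self ..) hba]
        exact ih _ _ h
      · split at h
        · rename_i i j hi hj
          split at h
          · rename_i x y hx hy
            have hi' : a i < b i := by simpa using List.find?_some hi
            have hj' : b j < a j := by simpa using List.find?_some hj
            have hij : i ≠ j := by rintro rfl; omega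
            obtain ⟨hx0, hx⟩ := ih _ _ hx
            obtain ⟨hy0, hy⟩ := ih _ _ hy
            obtain rfl := Option.some.inj h
            refine ⟨by positivity, ?_⟩
            rw [volume_rowPolytope_eq_add hij (Nat.sub_pos_of_lt hj') (Nat.sub_pos_of_lt hi'),
              hx, hy, ← mul_assoc, ← mul_assoc, ← add_mul, ← ENNReal.ofReal_mul (by positivity),
              ← ENNReal.ofReal_mul (by positivity),
              ← ENNReal.ofReal_add (by positivity) (by positivity)]
            norm_cast
          · simp at h
        · simp at h

/-- The volume of the dilated standard simplex. -/
theorem volume_setOf_nonneg_sum_le (n : ℕ) {r : ℝ} (hr : 0 ≤ r) :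
    volume {t : Fin n → ℝ | (∀ p, 0 ≤ t p) ∧ ∑ p, t p ≤ r} =
      ENNReal.ofReal (r ^ n / n.factorial) := by
  induction n generalizing r with
  | zero => simp [hr, volume_pi]
  | succ n ih =>
    have hmeas : MeasurableSet {x : ℝ × (Fin n → ℝ) |
        0 ≤ x.1 ∧ (∀ p, 0 ≤ x.2 p) ∧ x.1 + ∑ p, x.2 p ≤ r} := by
      have : {x : ℝ × (Fin n → ℝ) | 0 ≤ x.1 ∧ (∀ p, 0 ≤ x.2 p) ∧ x.1 + ∑ p, x.2 p ≤ r} =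
          {x | 0 ≤ x.1} ∩ ((⋂ p, {x | 0 ≤ x.2 p}) ∩ {x | x.1 + ∑ p, x.2 p ≤ r}) := by
        ext; simp
      rw [this]
      exact ((isClosed_le (by fun_prop) (by fun_prop)).inter
        ((isClosed_iInter fun p => isClosed_le (by fun_prop) (by fun_prop)).inter
          (isClosed_le (by fun_prop) (by fun_prop)))).measurableSet
    have hpre : {t : Fin (n + 1) → ℝ | (∀ p, 0 ≤ t p) ∧ ∑ p, t p ≤ r} =
        MeasurableEquiv.piFinSuccAbove (fun _ => ℝ) 0 ⁻¹' {x : ℝ × (Fin n → ℝ) |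
          0 ≤ x.1 ∧ (∀ p, 0 ≤ x.2 p) ∧ x.1 + ∑ p, x.2 p ≤ r} := by
      ext t
      simp [Fin.forall_fin_succ, Fin.sum_univ_succ, and_assoc, Fin.tail]
    have hsec (x : ℝ) : volume (Prod.mk x ⁻¹' {x : ℝ × (Fin n → ℝ) |
          0 ≤ x.1 ∧ (∀ p, 0 ≤ x.2 p) ∧ x.1 + ∑ p, x.2 p ≤ r}) =
        (Set.Icc 0 r).indicator (fun x => ENNReal.ofReal ((r - x) ^ n / n.factorial)) x := by
      by_cases hx : x ∈ Set.Icc 0 r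
      · rw [Set.indicator_of_mem hx, ← ih (sub_nonneg.2 hx.2)]
        congr 1
        ext t
        simp [hx.1, le_sub_iff_add_le']
      · rw [Set.indicator_of_notMem hx, ← measure_empty (μ := (volume : Measure (Fin n → ℝ)))]
        congr 1
        ext t
        simp only [Set.mem_preimage, Set.mem_ofPred_eq, Set.mem_empty_iff_false, iff_false]
        rintro ⟨h0, h1, h2⟩
        have := Finset.sum_nonneg fun p (_ : p ∈ Finset.univ) => h1 p
        exact hx ⟨h0, by linarith⟩
    rw [hpre, (volume_preserving_piFinSuccAbove (fun _ => ℝ) 0).measure_preimage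
      hmeas.nullMeasurableSet, Measure.volume_eq_prod, Measure.prod_apply hmeas]
    simp_rw [hsec]
    rw [lintegral_indicator measurableSet_Icc, ← ofReal_integral_eq_lintegral_ofReal]
    · congr 1
      rw [integral_Icc_eq_integral_Ioc, ← intervalIntegral.integral_of_le hr,
        intervalIntegral.integral_div, intervalIntegral.integral_comp_sub_left (fun x => x ^ n)]
      simp [Nat.factorial_succ]
      field_simp
    · exact (Continuous.integrableOn_Icc (by fun_prop))
    · filter_upwards [ae_restrict_mem measurableSet_Icc] with x hx
      have := sub_nonneg.2 hx.2
      positivity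

theorem volume_rowPolytope_one (ι : Type*) [Fintype ι] :
    volume (rowPolytope [(1 : ι → ℕ)]) =
      ENNReal.ofReal (1 / (Fintype.card ι).factorial) := by
  have h := volume_setOf_nonneg_sum_le (Fintype.card ι) zero_le_one
  have hpre : rowPolytope [(1 : ι → ℕ)] =
      MeasurableEquiv.piCongrLeft (fun _ => ℝ) (Fintype.equivFin ι) ⁻¹'
        {t : Fin (Fintype.card ι) → ℝ | (∀ p, 0 ≤ t p) ∧ ∑ p, t p ≤ 1} := by
    ext t
    have h (p : ι) : MeasurableEquiv.piCongrLeft (fun _ => ℝ) (Fintype.equivFin ι) t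
        (Fintype.equivFin ι p) = t p := by
      rw [MeasurableEquiv.coe_piCongrLeft, Equiv.piCongrLeft_apply_apply]
    simp [rowPolytope, (Fintype.equivFin ι).symm.forall_congr_left, h,
      ← Equiv.sum_comp (Fintype.equivFin ι)]
  rw [hpre, (volume_measurePreserving_piCongrLeft (fun _ => ℝ)
    (Fintype.equivFin ι)).measure_preimage_equiv, h, one_pow]

/-- the 6-dimensional Lebesgue volume of the polytope
`{t_{j,k} ≥ 0, t_{j,k} + t_{j,l} + 2t_{k,j} + 2t_{l,j} ≤ 1 for (j,k,l) cyclic}` equals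
`1/(4·6!) = 1/2880`. -/
theorem stmt7 :
    volume {t : Pair → ℝ | (∀ p, 0 ≤ t p) ∧
        ∀ (j k l : Fin 3) (hjk : j ≠ k) (hjl : j ≠ l) (_ : k ≠ l),
          t ⟨(j, k), hjk⟩ + t ⟨(j, l), hjl⟩ + 2 * t ⟨(k, j), hjk.symm⟩ +
            2 * t ⟨(l, j), hjl.symm⟩ ≤ 1}
      = ENNReal.ofReal (1 / 2880) := by
  have h := (volume_rowPolytope_of_relVolume _ _ _ _ relVolume_eval).2
  rw [volume_rowPolytope_one, ← ENNReal.ofReal_mul (by norm_num)] at h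
  convert h using 2
  · ext t
    have hu : (Finset.univ : Finset Pair) = {⟨(0, 1), by decide⟩, ⟨(0, 2), by decide⟩,
        ⟨(1, 0), by decide⟩, ⟨(1, 2), by decide⟩, ⟨(2, 0), by decide⟩, ⟨(2, 1), by decide⟩} := by
      decide
    simp only [rowPolytope, Set.mem_ofPred_eq, and_congr_right_iff]
    intro _
    simp [hu, Fin.forall_fin_succ]
    constructor
    · rintro ⟨⟨h1, -⟩, ⟨h2, -⟩, h3, -⟩
      refine ⟨?_, ?_, ?_⟩ <;> linarith
    · rintro ⟨h1, h2, h3⟩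
      refine ⟨⟨?_, ?_⟩, ⟨?_, ?_⟩, ?_, ?_⟩ <;> linarith
  · have : Fintype.card Pair = 6 := by decide
    rw [this]
    norm_num [Nat.factorial]
end

section
/- Let G = (V, E) be the graph with nine vertices V = {(1),(2),(3)} ∪ {(j,k) : j ≠ k ∈ {1,2,3}} and nine edges: {(j),(k,j)} for all j ≠ k, and {(j,k),(k,j)} for j < k. Let E′ be the set of all pairs of distinct vertices not adjacent in G. For d̃ ∈ {0,1}^{E′} and v ∈ V set r̃_v(d̃) = max{ d̃_α : α ∈ E′, v ∈ α }. Then in ℤ[x] one has Σ_{d̃ ∈ {0,1}^{E′}} ∏_{α ∈ E′} (−1)^{d̃_α} · x^{Σ_{v∈V} r̃_v(d̃)} = (1−x)⁷ · (1 + 7x + x²). -/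
open Polynomial

/-- The nine vertices `V = {(1),(2),(3)} ∪ {(j,k) : j ≠ k}` of the graph `G`. -/
abbrev Vtx : Type := Fin 3 ⊕ Pair

/-- `rel u v` holds for the edges `{(j),(k,j)}` (for all `j ≠ k`) and `{(j,k),(k,j)}`. -/
def rel : Vtx → Vtx → Bool
  | Sum.inl j, Sum.inr p => p.1.2 == j
  | Sum.inr p, Sum.inr q => q.1.1 == p.1.2 && q.1.2 == p.1.1
  | _, _ => false

/-- Adjacency in the graph `G = (V,E)` with the nine edges `{(j),(k,j)}` (`j ≠ k`) and
`{(j,k),(k,j)}` (`j < k`). -/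
def adj (u v : Vtx) : Bool := rel u v || rel v u

/-- `E′`: the unordered pairs of distinct vertices of `V` that are not adjacent in `G`. -/
abbrev Ep : Type := {e : Sym2 Vtx // ¬ e.IsDiag ∧ ∀ u v : Vtx, e = s(u, v) → adj u v = false}

instance : Fintype Ep := inferInstance

/-- `r̃_v(d̃) = max{d̃_α : α ∈ E′, v ∈ α}` (with `max ∅ = 0`), for `d̃ ∈ {0,1}^{E′}`. -/
def rt (d : Ep → Bool) (v : Vtx) : ℕ :=
  (Finset.univ.filter fun α : Ep => v ∈ (α : Sym2 Vtx)).sup fun α => if d α then 1 else 0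

/-- `W` contains no pair of `E′` if and only if `W` is a clique of `G`. -/
theorem forall_ep_not_subset_iff (W : Finset Vtx) :
    (∀ α : Ep, ∃ v ∈ (α : Sym2 Vtx), v ∉ W) ↔ ∀ u ∈ W, ∀ v ∈ W, u ≠ v → adj u v = true := by
  constructor
  · intro h u hu v hv huv
    by_contra hadj
    obtain ⟨w, hw, hwW⟩ := h ⟨s(u, v), by simpa using huv, by
      intro a b hab
      rcases Sym2.eq_iff.mp hab with ⟨rfl, rfl⟩ | ⟨rfl, rfl⟩
      · simpa using hadj
      · rw [adj, Bool.or_comm]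
        simpa [adj] using hadj⟩
    rcases Sym2.mem_iff.mp hw with rfl | rfl <;> contradiction
  · rintro h ⟨e, he, hadj⟩
    induction e with
    | h u v =>
      by_contra! hW
      have := h u (hW u (Sym2.mem_mk_left u v)) v (hW v (Sym2.mem_mk_right u v)) (by simpa using he)
      simp [hadj u v rfl] at this

theorem pow_rt {R : Type*} [CommRing R] (x : R) (d : Ep → Bool) (v : Vtx) :
    x ^ rt d v =
      x + (1 - x) * ∏ α : Ep, if v ∈ (α : Sym2 Vtx) ∧ d α = true then 0 else 1 := by
  by_cases h : ∃ α : Ep, v ∈ (α : Sym2 Vtx) ∧ d α = true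
  · obtain ⟨α, hv, hd⟩ := h
    have hrt : rt d v = 1 := by
      apply le_antisymm
      · exact Finset.sup_le fun β _ => by split_ifs <;> simp
      · have hα : α ∈ Finset.univ.filter fun α : Ep => v ∈ (α : Sym2 Vtx) :=
          Finset.mem_filter.mpr ⟨Finset.mem_univ α, hv⟩
        exact (if_pos hd).symm.trans_le
          (Finset.le_sup (f := fun α : Ep => if d α then 1 else 0) hα)
    have hprod : (∏ α : Ep, if v ∈ (α : Sym2 Vtx) ∧ d α = true then (0 : R) else 1) = 0 :=
      Finset.prod_eq_zero (Finset.mem_univ α) (if_pos ⟨hv, hd⟩)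
    rw [hrt, hprod]
    simp
  · push Not at h
    have hrt : rt d v = 0 := by
      refine Nat.le_zero.mp (Finset.sup_le fun β hβ => ?_)
      simp [h β (Finset.mem_filter.mp hβ).2]
    rw [hrt, Finset.prod_eq_one fun α _ => if_neg fun hα => h α hα.1 hα.2]
    simp

theorem sum_sign_mul_indicator (R : Type*) [CommRing R] (W : Finset Vtx) :
    (∑ d : Ep → Bool, (∏ α : Ep, (-1 : R) ^ (if d α then 1 else 0)) *
        ∏ v ∈ Wᶜ, ∏ α : Ep, if v ∈ (α : Sym2 Vtx) ∧ d α = true then 0 else 1) =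
      if ∀ u ∈ W, ∀ v ∈ W, u ≠ v → adj u v = true then (1 : R) else 0 := by
  let f (α : Ep) (b : Bool) : R := (-1) ^ (if b then 1 else 0) *
    ∏ v ∈ Wᶜ, if v ∈ (α : Sym2 Vtx) ∧ b = true then 0 else 1
  have hfactor (d : Ep → Bool) :
      (∏ α : Ep, (-1 : R) ^ (if d α then 1 else 0)) *
        (∏ v ∈ Wᶜ, ∏ α : Ep, if v ∈ (α : Sym2 Vtx) ∧ d α = true then 0 else 1) =
      ∏ α : Ep, f α (d α) := by
    rw [Finset.prod_comm, ← Finset.prod_mul_distrib]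
  have hfalse (α : Ep) : f α false = 1 := by simp [f]
  refine (Finset.sum_congr rfl fun d _ => hfactor d).trans ((Fintype.prod_sum f).symm.trans ?_)
  simp only [← forall_ep_not_subset_iff]
  split_ifs with h
  · refine Finset.prod_eq_one fun α _ => ?_
    obtain ⟨v, hv, hvW⟩ := h α
    have htrue : f α true = 0 :=
      mul_eq_zero_of_right _ (Finset.prod_eq_zero (Finset.mem_compl.mpr hvW) (if_pos ⟨hv, rfl⟩))
    rw [Fintype.sum_bool, htrue, hfalse, zero_add]
  · push Not at h
    obtain ⟨α, hα⟩ := h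
    refine Finset.prod_eq_zero (Finset.mem_univ α) ?_
    have htrue : f α true = -1 :=
      (congrArg ((-1 : R) ^ 1 * ·) (Finset.prod_eq_one fun v hv =>
        if_neg fun hvα : v ∈ (α : Sym2 Vtx) ∧ true = true =>
          Finset.mem_compl.mp hv (hα v hvα.1))).trans (by simp)
    rw [Fintype.sum_bool, htrue, hfalse, neg_add_cancel]

theorem card_vtx : Fintype.card Vtx = 9 := by
  decide +kernel

theorem pow_sum_rt {R : Type*} [CommRing R] (x : R) (d : Ep → Bool) :
    x ^ (∑ v : Vtx, rt d v) = ∑ W : Finset Vtx, x ^ W.card * (1 - x) ^ (9 - W.card) *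
      ∏ v ∈ Wᶜ, ∏ α : Ep, if v ∈ (α : Sym2 Vtx) ∧ d α = true then 0 else 1 := by
  rw [← Finset.prod_pow_eq_pow_sum, Finset.prod_congr rfl fun v _ => pow_rt x d v,
    Fintype.prod_add]
  refine Finset.sum_congr rfl fun W _ => ?_
  rw [Finset.prod_mul_distrib, Finset.prod_const, Finset.prod_const, Finset.card_compl,
    card_vtx, mul_assoc]

theorem sum_mul_sum_mul_comm {ι κ R : Type*} [CommSemiring R] (s : Finset ι) (t : Finset κ)
    (a : ι → R) (b : κ → R) (c : ι → κ → R) :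
    ∑ i ∈ s, a i * ∑ j ∈ t, b j * c i j = ∑ j ∈ t, b j * ∑ i ∈ s, a i * c i j := by
  simp only [Finset.mul_sum]
  rw [Finset.sum_comm]
  simp only [mul_left_comm]

/-- The clique expansion of the signed sum over `{0,1}^{E′}`. -/
theorem sum_eq_sum_cliques {R : Type*} [CommRing R] (x : R) :
    (∑ d : Ep → Bool,
      (∏ α : Ep, (-1 : R) ^ (if d α then 1 else 0)) * x ^ (∑ v : Vtx, rt d v)) =
    ∑ W : Finset Vtx with ∀ u ∈ W, ∀ v ∈ W, u ≠ v → adj u v = true,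
      x ^ W.card * (1 - x) ^ (9 - W.card) := by
  rw [Finset.sum_filter]
  refine (Finset.sum_congr rfl fun d _ => congrArg _ (pow_sum_rt x d)).trans
    ((sum_mul_sum_mul_comm _ _ _ _ _).trans (Finset.sum_congr rfl fun W _ => ?_))
  rw [sum_sign_mul_indicator, mul_boole]

/-- The nonempty cliques of `G` are its nine vertices and its nine edges. -/
theorem card_cliques (k : Fin 10) :
    (Finset.univ.filter fun W : Finset Vtx =>
      (∀ u ∈ W, ∀ v ∈ W, u ≠ v → adj u v = true) ∧ W.card = (k : ℕ)).card =
      ![1, 9, 9, 0, 0, 0, 0, 0, 0, 0] k := by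
  revert k
  decide +kernel

/-- the Möbius polynomial identity: in `ℤ[x]`,
`Σ_{d̃ ∈ {0,1}^{E′}} ∏_{α ∈ E′} (−1)^{d̃_α} · x^{Σ_v r̃_v(d̃)} = (1−x)⁷·(1+7x+x²)`. -/
theorem stmt8 :
    (∑ d : Ep → Bool,
      C (∏ α : Ep, (-1 : ℤ) ^ (if d α then 1 else 0)) * X ^ (∑ v : Vtx, rt d v))
    = (1 - X) ^ 7 * (1 + 7 * X + X ^ 2) := by
  simp only [map_prod, map_pow, map_neg, map_one]
  rw [sum_eq_sum_cliques, ← Finset.sum_fiberwise_of_maps_to (t := Finset.range 10)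
    (g := Finset.card) fun W _ => Finset.mem_range.mpr
      (Nat.lt_succ_of_le (card_vtx ▸ Finset.card_le_univ W))]
  have hfiber (k : Fin 10) :
      (∑ W ∈ (Finset.univ.filter fun W : Finset Vtx =>
          ∀ u ∈ W, ∀ v ∈ W, u ≠ v → adj u v = true) with W.card = (k : ℕ),
        (X : ℤ[X]) ^ W.card * (1 - X) ^ (9 - W.card)) =
      ((![1, 9, 9, 0, 0, 0, 0, 0, 0, 0] k : ℕ) : ℤ[X]) *
         ((X : ℤ[X]) ^ (k : ℕ) * (1 - X) ^ (9 - (k : ℕ))) := by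
    rw [Finset.sum_congr rfl fun W hW => by rw [(Finset.mem_filter.mp hW).2], Finset.sum_const,
      Finset.filter_filter, card_cliques, nsmul_eq_mul]
  rw [Finset.sum_range, Finset.sum_congr rfl fun k _ => hfiber k]
  simp [Fin.sum_univ_succ]
  ring
end
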